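/- Let s > 1/2, u ∈ 𝒮'(ℝ^m), v ∈ 𝒮'(ℝ^n), φ ∈ Σ_s(ℝ^m) \ {0}, ψ ∈ Σ_s(ℝ^n) \ {0}, and let w ∈ 𝒮'(ℝ^{m+n}) be such that for all (x,ξ) ∈ ℝ^{2(m+n)}, writing x = (x',x'') ∈ ℝ^m × ℝ^n and ξ = (ξ',ξ'') ∈ ℝ^m × ℝ^n, one has V_{φ⊗ψ} w(x,ξ) = V_φ u(x',ξ') · V_ψ v(x'',ξ''), where φ⊗ψ(x',x'') := φ(x') ψ(x'') (this identity characterizes w = u ⊗ v). Then WF^s(w) ⊆ { (x,ξ) ∈ ℝ^{2(m+n)} \ {0} : (x',ξ') ∈ WF^s(u) ∪ {0} and (x'',ξ'') ∈ WF^s(v) ∪ {0} }. -/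

import Mathlib

open MeasureTheory Filter
open scoped BigOperators ENNReal RealInnerProductSpace

noncomputable section

/-- `ℝ^d` with the Euclidean norm. -/
abbrev Ed (d : ℕ) : Type := EuclideanSpace ℝ (Fin d)

/-- Partial derivative along the `i`-th coordinate direction. -/
def pdGS {d : ℕ} (i : Fin d) (f : Ed d → ℂ) : Ed d → ℂ :=
  fun x => fderiv ℝ f x (EuclideanSpace.single i 1)

/-- Multi-index partial derivative `∂^β`. -/
def mderiv {d : ℕ} (β : Fin d → ℕ) (f : Ed d → ℂ) : Ed d → ℂ :=
  ((List.ofFn fun i : Fin d => (pdGS i)^[β i]).foldr (· ∘ ·) id) f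

/-- Monomial `x^α`. -/
def mpow {d : ℕ} (x : Ed d) (α : Fin d → ℕ) : ℝ := ∏ i, x i ^ α i

/-- Multi-index factorial `α!`. -/
def mfact {d : ℕ} (α : Fin d → ℕ) : ℕ := ∏ i, Nat.factorial (α i)

/-- Multi-index length `|α|`. -/
def mlen {d : ℕ} (α : Fin d → ℕ) : ℕ := ∑ i, α i

/-- The Gelfand–Shilov seminorm `‖f‖_{S_{s,h}}`, valued in `[0,∞]`. -/
def GSnorm {d : ℕ} (s h : ℝ) (f : Ed d → ℂ) : ℝ≥0∞ :=
  ⨆ (x : Ed d) (α : Fin d → ℕ) (β : Fin d → ℕ),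
    ENNReal.ofReal (|mpow x α| * ‖mderiv β f x‖ /
      (h ^ (mlen α + mlen β) * ((mfact α : ℝ) * (mfact β : ℝ)) ^ s))

/-- The Gelfand–Shilov space `Σ_s(ℝ^d)`: smooth functions all of whose
`S_{s,h}` seminorms are finite. -/
def SigmaGS (s : ℝ) (d : ℕ) : Set (Ed d → ℂ) :=
  {f | ContDiff ℝ ((⊤ : ℕ∞) : WithTop ℕ∞) f ∧ ∀ h : ℝ, 0 < h → GSnorm s h f < ⊤}

/-- The seminorm `|f|_A`, valued in `[0,∞]`. -/
def GSnormA {d : ℕ} (s A : ℝ) (f : Ed d → ℂ) : ℝ≥0∞ :=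
  ⨆ (x : Ed d) (β : Fin d → ℕ),
    ENNReal.ofReal (A ^ mlen β * Real.exp (A * ‖x‖ ^ (1/s)) * ‖mderiv β f x‖ /
      (mfact β : ℝ) ^ s)

/-- The Fourier transform `f̂(ξ) = ∫ f(x) e^{-i⟨x,ξ⟩} dx`. -/
def FTgs {d : ℕ} (f : Ed d → ℂ) (ξ : Ed d) : ℂ :=
  ∫ x : Ed d, f x * Complex.exp (-(Complex.I * (⟪x, ξ⟫ : ℝ)))

/-- The short-time Fourier transform of a function `f` with window `φ`. -/
def STFTgs {d : ℕ} (φ f : Ed d → ℂ) (z : Ed d × Ed d) : ℂ :=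
  ∫ y : Ed d, f y * (starRingEnd ℂ) (φ (y - z.1)) * Complex.exp (-(Complex.I * (⟪y, z.2⟫ : ℝ)))

/-- Euclidean norm of a phase-space point `(x,ξ) ∈ ℝ^{2d}`. -/
def pnorm {d : ℕ} (z : Ed d × Ed d) : ℝ := Real.sqrt (‖z.1‖ ^ 2 + ‖z.2‖ ^ 2)

/-- A conic subset: invariant under multiplication by positive reals. -/
def IsConic {V : Type*} [SMul ℝ V] (Γ : Set V) : Prop :=
  ∀ t : ℝ, 0 < t → ∀ z ∈ Γ, t • z ∈ Γ

/-- Tempered distributions on `ℝ^d`. -/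
abbrev TD (d : ℕ) : Type := SchwartzMap (Ed d) ℂ →L[ℂ] ℂ

/-- `W` is the short-time Fourier transform `V_φ u` of the tempered distribution `u`
with respect to the window `φ`. -/
def IsSTFT {d : ℕ} (u : TD d) (φ : Ed d → ℂ) (W : Ed d × Ed d → ℂ) : Prop :=
  ∀ (x ξ : Ed d) (g : SchwartzMap (Ed d) ℂ),
    (∀ y : Ed d, g y = (starRingEnd ℂ) (φ (y - x)) * Complex.exp (-(Complex.I * (⟪y, ξ⟫ : ℝ)))) →
    W (x, ξ) = u g

/-- The `s`-Gelfand–Shilov wave front set of a distribution whose short-time Fourier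
transform is `W`: the set of nonzero phase-space points having no open conic
neighbourhood on which `e^{A|z|^{1/s}} |W(z)|` is bounded for every `A > 0`. -/
def WFs {d : ℕ} (s : ℝ) (W : Ed d × Ed d → ℂ) : Set (Ed d × Ed d) :=
  {z₀ | z₀ ≠ 0 ∧ ¬ ∃ Γ : Set (Ed d × Ed d), IsOpen Γ ∧ IsConic Γ ∧
    (0 : Ed d × Ed d) ∉ Γ ∧ z₀ ∈ Γ ∧
    ∀ A : ℝ, 0 < A → ∃ C : ℝ, ∀ z ∈ Γ, Real.exp (A * pnorm z ^ (1/s)) * ‖W z‖ ≤ C}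

/-- The real quadratic form `⟨Bx, x⟩` of a matrix `B`. -/
def qf {d : ℕ} (B : Matrix (Fin d) (Fin d) ℝ) (x : Ed d) : ℝ :=
  ∑ i, (∑ j, B i j * x j) * x i

/-- Tempered distributions on `ℝ^m × ℝ^n`. -/
abbrev TD2 (m n : ℕ) : Type := SchwartzMap (Ed m × Ed n) ℂ →L[ℂ] ℂ

/-- Short-time Fourier transform of a tempered distribution on `ℝ^m × ℝ^n`. -/
def IsSTFT2 {m n : ℕ} (w : TD2 m n) (Φ : Ed m × Ed n → ℂ)
    (W : (Ed m × Ed n) × (Ed m × Ed n) → ℂ) : Prop :=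
  ∀ (x ξ : Ed m × Ed n) (g : SchwartzMap (Ed m × Ed n) ℂ),
    (∀ y : Ed m × Ed n, g y = (starRingEnd ℂ) (Φ (y - x)) *
      Complex.exp (-(Complex.I * ((⟪y.1, ξ.1⟫ + ⟪y.2, ξ.2⟫ : ℝ))))) →
    W (x, ξ) = w g

/-- Euclidean norm of a phase-space point of `T^*(ℝ^m × ℝ^n)`. -/
def pnorm2 {m n : ℕ} (z : (Ed m × Ed n) × (Ed m × Ed n)) : ℝ :=
  Real.sqrt (‖z.1.1‖ ^ 2 + ‖z.1.2‖ ^ 2 + ‖z.2.1‖ ^ 2 + ‖z.2.2‖ ^ 2)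

/-- The `s`-Gelfand–Shilov wave front set on `ℝ^m × ℝ^n`. -/
def WFs2 {m n : ℕ} (s : ℝ) (W : (Ed m × Ed n) × (Ed m × Ed n) → ℂ) :
    Set ((Ed m × Ed n) × (Ed m × Ed n)) :=
  {z₀ | z₀ ≠ 0 ∧ ¬ ∃ Γ : Set ((Ed m × Ed n) × (Ed m × Ed n)), IsOpen Γ ∧ IsConic Γ ∧
    (0 : (Ed m × Ed n) × (Ed m × Ed n)) ∉ Γ ∧ z₀ ∈ Γ ∧
    ∀ A : ℝ, 0 < A → ∃ C : ℝ, ∀ z ∈ Γ, Real.exp (A * pnorm2 z ^ (1/s)) * ‖W z‖ ≤ C}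

theorem contDiff_pdGS {d : ℕ} (i : Fin d) {f : Ed d → ℂ}
    (hf : ContDiff ℝ ((⊤ : ℕ∞) : WithTop ℕ∞) f) :
    ContDiff ℝ ((⊤ : ℕ∞) : WithTop ℕ∞) (pdGS i f) :=
  (hf.fderiv_right (m := ((⊤ : ℕ∞) : WithTop ℕ∞)) (by simp)).clm_apply contDiff_const

theorem contDiff_pdGS_iterate {d : ℕ} (i : Fin d) (k : ℕ) {f : Ed d → ℂ}
    (hf : ContDiff ℝ ((⊤ : ℕ∞) : WithTop ℕ∞) f) :
    ContDiff ℝ ((⊤ : ℕ∞) : WithTop ℕ∞) ((pdGS i)^[k] f) := by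
  induction k with
  | zero => exact hf
  | succ k ih => rw [Function.iterate_succ_apply']; exact contDiff_pdGS i ih

theorem pdGS_comm {d : ℕ} (i j : Fin d) {f : Ed d → ℂ}
    (hf : ContDiff ℝ ((⊤ : ℕ∞) : WithTop ℕ∞) f) :
    pdGS i (pdGS j f) = pdGS j (pdGS i f) := by
  have hd : Differentiable ℝ (fderiv ℝ f) :=
    (hf.fderiv_right (m := ((⊤ : ℕ∞) : WithTop ℕ∞)) (by simp)).differentiable (by simp)
  have key : ∀ (a b : Fin d) (x : Ed d), pdGS a (pdGS b f) x =
      fderiv ℝ (fderiv ℝ f) x (EuclideanSpace.single a 1) (EuclideanSpace.single b 1) := by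
    intro a b x
    change fderiv ℝ (fun y => fderiv ℝ f y (EuclideanSpace.single b 1)) x _ = _
    rw [fderiv_clm_apply (hd x) (differentiableAt_const _)]
    simp
  funext x
  rw [key, key]
  exact (hf.contDiffAt.isSymmSndFDerivAt (by
    rw [minSmoothness_of_isRCLikeNormedField]
    exact WithTop.coe_le_coe.2 le_top)) _ _

theorem pdGS_iterate_comm {d : ℕ} (i j : Fin d) (k : ℕ) {f : Ed d → ℂ}
    (hf : ContDiff ℝ ((⊤ : ℕ∞) : WithTop ℕ∞) f) :
    (pdGS j)^[k] (pdGS i f) = pdGS i ((pdGS j)^[k] f) := by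
  induction k with
  | zero => rfl
  | succ k ih =>
    rw [Function.iterate_succ_apply', Function.iterate_succ_apply', ih,
      pdGS_comm i j (contDiff_pdGS_iterate j k hf)]

/-- The composition of the iterated partial derivatives along the directions listed in `l`. -/
def listDeriv {d : ℕ} (β : Fin d → ℕ) (l : List (Fin d)) (f : Ed d → ℂ) : Ed d → ℂ :=
  ((l.map fun i => (pdGS i)^[β i]).foldr (· ∘ ·) id) f

theorem listDeriv_cons {d : ℕ} (β : Fin d → ℕ) (j : Fin d) (l : List (Fin d)) (f : Ed d → ℂ) :
    listDeriv β (j :: l) f = (pdGS j)^[β j] (listDeriv β l f) := rfl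

theorem mderiv_eq_listDeriv {d : ℕ} (β : Fin d → ℕ) (f : Ed d → ℂ) :
    mderiv β f = listDeriv β (List.finRange d) f := by
  rw [mderiv, listDeriv, List.ofFn_eq_map]

theorem contDiff_listDeriv {d : ℕ} (β : Fin d → ℕ) (l : List (Fin d)) {f : Ed d → ℂ}
    (hf : ContDiff ℝ ((⊤ : ℕ∞) : WithTop ℕ∞) f) :
    ContDiff ℝ ((⊤ : ℕ∞) : WithTop ℕ∞) (listDeriv β l f) := by
  induction l with
  | nil => exact hf
  | cons j l ih => rw [listDeriv_cons]; exact contDiff_pdGS_iterate j _ ih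

theorem listDeriv_pdGS {d : ℕ} (β : Fin d → ℕ) (i : Fin d) (l : List (Fin d)) {f : Ed d → ℂ}
    (hf : ContDiff ℝ ((⊤ : ℕ∞) : WithTop ℕ∞) f) :
    listDeriv β l (pdGS i f) = pdGS i (listDeriv β l f) := by
  induction l with
  | nil => rfl
  | cons j l ih =>
    rw [listDeriv_cons, listDeriv_cons, ih, pdGS_iterate_comm i j _ (contDiff_listDeriv β l hf)]

theorem listDeriv_add_single_of_notMem {d : ℕ} (β : Fin d → ℕ) (i : Fin d) (l : List (Fin d))
    (hi : i ∉ l) (f : Ed d → ℂ) :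
    listDeriv (β + Pi.single i 1) l f = listDeriv β l f := by
  induction l with
  | nil => rfl
  | cons j l ih =>
    simp only [List.mem_cons, not_or] at hi
    rw [listDeriv_cons, listDeriv_cons, ih hi.2]
    simp [Pi.single_eq_of_ne' hi.1]

theorem listDeriv_add_single_of_mem {d : ℕ} (β : Fin d → ℕ) (i : Fin d) (l : List (Fin d))
    (hl : l.Nodup) (hi : i ∈ l) {f : Ed d → ℂ}
    (hf : ContDiff ℝ ((⊤ : ℕ∞) : WithTop ℕ∞) f) :
    listDeriv (β + Pi.single i 1) l f = pdGS i (listDeriv β l f) := by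
  induction l with
  | nil => simp at hi
  | cons j l ih =>
    rw [List.nodup_cons] at hl
    rw [listDeriv_cons, listDeriv_cons]
    by_cases hij : i = j
    · subst hij
      rw [listDeriv_add_single_of_notMem β i l hl.1, ← Function.iterate_succ_apply' (pdGS i)]
      simp
    · rw [ih hl.2 ((List.mem_cons.1 hi).resolve_left hij),
        ← pdGS_iterate_comm i j _ (contDiff_listDeriv β l hf)]
      simp [Pi.single_eq_of_ne' hij]

theorem mderiv_pdGS {d : ℕ} (β : Fin d → ℕ) (i : Fin d) {f : Ed d → ℂ}
    (hf : ContDiff ℝ ((⊤ : ℕ∞) : WithTop ℕ∞) f) :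
    mderiv β (pdGS i f) = mderiv (β + Pi.single i 1) f := by
  rw [mderiv_eq_listDeriv, mderiv_eq_listDeriv, listDeriv_pdGS β i _ hf,
    listDeriv_add_single_of_mem β i _ (List.nodup_finRange d) (List.mem_finRange i) hf]

theorem mderiv_zero {d : ℕ} (f : Ed d → ℂ) : mderiv 0 f = f := by
  rw [mderiv_eq_listDeriv]
  induction List.finRange d with
  | nil => rfl
  | cons j l ih => rw [listDeriv_cons, ih]; rfl

theorem fderiv_eq_sum_pdGS {d : ℕ} (f : Ed d → ℂ) :
    fderiv ℝ f = fun x => ∑ i : Fin d,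
      (ContinuousLinearMap.smulRightL ℝ (Ed d) ℂ (EuclideanSpace.proj i)) (pdGS i f x) := by
  funext x
  refine ContinuousLinearMap.ext fun v => ?_
  conv_lhs => rw [← (EuclideanSpace.basisFun (Fin d) ℝ).sum_repr v]
  simp [pdGS]

theorem decay_iteratedFDeriv {d : ℕ} (N k : ℕ) : ∀ f : Ed d → ℂ,
    ContDiff ℝ ((⊤ : ℕ∞) : WithTop ℕ∞) f →
    (∀ β : Fin d → ℕ, ∃ C, ∀ x, ‖x‖ ^ N * ‖mderiv β f x‖ ≤ C) →
    ∃ C, ∀ x, ‖x‖ ^ N * ‖iteratedFDeriv ℝ k f x‖ ≤ C := by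
  induction k with
  | zero =>
    intro f _ h
    obtain ⟨C, hC⟩ := h 0
    refine ⟨C, fun x => ?_⟩
    simpa [mderiv_zero] using hC x
  | succ k ih =>
    intro f hf h
    have h1 : ∀ i : Fin d, ∃ C, ∀ x, ‖x‖ ^ N * ‖iteratedFDeriv ℝ k (pdGS i f) x‖ ≤ C := by
      intro i
      refine ih _ (contDiff_pdGS i hf) fun β => ?_
      rw [mderiv_pdGS β i hf]
      exact h _
    choose C hC using h1
    let L : Fin d → ℂ →L[ℝ] (Ed d →L[ℝ] ℂ) := fun i =>
      ContinuousLinearMap.smulRightL ℝ (Ed d) ℂ (EuclideanSpace.proj i)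
    refine ⟨∑ i, ‖L i‖ * C i, fun x => ?_⟩
    have hpd : ∀ i, ContDiff ℝ ((⊤ : ℕ∞) : WithTop ℕ∞) (pdGS i f) := fun i => contDiff_pdGS i hf
    have hk : (k : WithTop ℕ∞) ≤ ((⊤ : ℕ∞) : WithTop ℕ∞) := WithTop.coe_le_coe.2 le_top
    rw [← norm_iteratedFDeriv_fderiv, fderiv_eq_sum_pdGS, iteratedFDeriv_fun_sum_apply]
    · calc ‖x‖ ^ N * ‖∑ i, iteratedFDeriv ℝ k (fun y => L i (pdGS i f y)) x‖
          ≤ ‖x‖ ^ N * ∑ i, ‖L i‖ * ‖iteratedFDeriv ℝ k (pdGS i f) x‖ := by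
            gcongr
            refine (norm_sum_le _ _).trans (Finset.sum_le_sum fun i _ => ?_)
            exact (L i).norm_iteratedFDeriv_comp_left (hpd i).contDiffAt hk
        _ = ∑ i, ‖L i‖ * (‖x‖ ^ N * ‖iteratedFDeriv ℝ k (pdGS i f) x‖) := by
            rw [Finset.mul_sum]; exact Finset.sum_congr rfl fun i _ => by ring
        _ ≤ _ := by
            gcongr with i
            exact hC i x
    · exact fun i _ => ((L i).contDiff.comp ((hpd i).of_le hk)).contDiffAt

theorem norm_pow_le_sum_mpow {d : ℕ} (N : ℕ) :
    ∃ K : ℝ, 0 ≤ K ∧ ∀ x : Ed d, ‖x‖ ^ (N + 1) ≤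
      K * ∑ i : Fin d, |mpow x (Pi.single i (N + 1))| := by
  refine ⟨(d : ℝ) ^ N, by positivity, fun x => ?_⟩
  have h1 : ‖x‖ ≤ ∑ i, |x i| := by
    conv_lhs => rw [← (EuclideanSpace.basisFun (Fin d) ℝ).sum_repr x]
    refine (norm_sum_le _ _).trans (Finset.sum_le_sum fun i _ => ?_)
    simp [norm_smul]
  have h2 : ∀ i : Fin d, |mpow x (Pi.single i (N + 1))| = |x i| ^ (N + 1) := by
    intro i
    rw [mpow, Finset.prod_eq_single i]
    · simp [abs_pow]
    · intro j _ hj; simp [Pi.single_eq_of_ne hj]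
    · simp
  simp_rw [h2]
  calc ‖x‖ ^ (N + 1) ≤ (∑ i, |x i|) ^ (N + 1) := by gcongr
    _ ≤ _ := by
      simpa using pow_sum_le_card_mul_sum_pow (s := Finset.univ) (f := fun i => |x i|)
        (fun i _ => abs_nonneg _) N

theorem decay_mderiv {d : ℕ} {s : ℝ} {f : Ed d → ℂ} (hf : f ∈ SigmaGS s d) (N : ℕ)
    (β : Fin d → ℕ) : ∃ C, ∀ x, ‖x‖ ^ N * ‖mderiv β f x‖ ≤ C := by
  have hα : ∀ α : Fin d → ℕ, ∃ C, ∀ x, |mpow x α| * ‖mderiv β f x‖ ≤ C := by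
    intro α
    refine ⟨(GSnorm s 1 f).toReal * ((mfact α : ℝ) * (mfact β : ℝ)) ^ s, fun x => ?_⟩
    have hpos : 0 < ((mfact α : ℝ) * (mfact β : ℝ)) ^ s := by
      have h : ∀ γ : Fin d → ℕ, (0 : ℝ) < mfact γ := fun γ => by
        exact_mod_cast Finset.prod_pos fun i _ => Nat.factorial_pos _
      exact Real.rpow_pos_of_pos (mul_pos (h α) (h β)) _
    rw [← div_le_iff₀ hpos]
    refine (ENNReal.ofReal_le_iff_le_toReal (hf.2 1 one_pos).ne).1 ?_
    refine le_trans (le_of_eq ?_) (le_iSup_of_le x (le_iSup_of_le α (le_iSup_of_le β le_rfl)))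
    simp
  cases N with
  | zero =>
    obtain ⟨C, hC⟩ := hα 0
    exact ⟨C, fun x => by simpa [mpow] using hC x⟩
  | succ N =>
    obtain ⟨K, hK, hx⟩ := norm_pow_le_sum_mpow (d := d) N
    choose C hC using fun i : Fin d => hα (Pi.single i (N + 1))
    refine ⟨K * ∑ i, C i, fun x => ?_⟩
    calc ‖x‖ ^ (N + 1) * ‖mderiv β f x‖
        ≤ (K * ∑ i : Fin d, |mpow x (Pi.single i (N + 1))|) * ‖mderiv β f x‖ := by
          gcongr; exact hx x
      _ = K * ∑ i : Fin d, |mpow x (Pi.single i (N + 1))| * ‖mderiv β f x‖ := by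
          rw [mul_assoc, Finset.sum_mul]
      _ ≤ _ := by gcongr with i; exact hC i x

/-- A Gelfand–Shilov function as a Schwartz function. -/
def SigmaGS.toSchwartz {d : ℕ} {s : ℝ} {f : Ed d → ℂ} (hf : f ∈ SigmaGS s d) :
    SchwartzMap (Ed d) ℂ where
  toFun := f
  smooth' := hf.1
  decay' N k := decay_iteratedFDeriv N k f hf.1 (decay_mderiv hf N)

theorem norm_iteratedFDeriv_cexp_clm_le {E : Type*} [NormedAddCommGroup E] [NormedSpace ℝ E]
    (L : E →L[ℝ] ℂ) (k : ℕ) (x : E) :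
    ‖iteratedFDeriv ℝ k (fun y => Complex.exp (L y)) x‖ ≤ ‖L‖ ^ k * ‖Complex.exp (L x)‖ := by
  have hsm : ContDiff ℝ ((⊤ : ℕ∞) : WithTop ℕ∞) (fun y => Complex.exp (L y)) :=
    L.contDiff.cexp
  induction k with
  | zero => simp
  | succ k ih =>
    have hfd : fderiv ℝ (fun y => Complex.exp (L y)) =
        (ContinuousLinearMap.toSpanSingleton ℂ L).restrictScalars ℝ ∘
          fun y => Complex.exp (L y) := by
      funext y
      rw [(L.hasFDerivAt.cexp).fderiv]
      rfl
    rw [← norm_iteratedFDeriv_fderiv, hfd]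
    refine (ContinuousLinearMap.norm_iteratedFDeriv_comp_left _ hsm.contDiffAt
      (WithTop.coe_le_coe.2 le_top)).trans ?_
    rw [ContinuousLinearMap.norm_restrictScalars, ContinuousLinearMap.norm_toSpanSingleton,
      pow_succ', mul_assoc]
    gcongr

theorem norm_iteratedFDeriv_modulated_le {d : ℕ} (f : SchwartzMap (Ed d) ℂ) (k l : ℕ) :
    ∃ C : ℝ, 0 ≤ C ∧ ∀ x ξ y : Ed d, ‖y‖ ^ k * ‖iteratedFDeriv ℝ l
      (fun y => (starRingEnd ℂ) (f (y - x)) * Complex.exp (-(Complex.I * (⟪y, ξ⟫ : ℝ)))) y‖ ≤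
      C * ((1 + ‖x‖) ^ k * (1 + ‖ξ‖) ^ l) := by
  let S : ℝ := 2 ^ k * ((Finset.Iic (k, l)).sup fun m => SchwartzMap.seminorm ℝ m.1 m.2) f
  have hS : 0 ≤ S := mul_nonneg (by positivity) (apply_nonneg _ _)
  refine ⟨∑ i ∈ Finset.range (l + 1), (l.choose i : ℝ) * S, by positivity, fun x ξ y => ?_⟩
  have hf : ContDiff ℝ ((⊤ : ℕ∞) : WithTop ℕ∞) fun y => (starRingEnd ℂ) (f (y - x)) :=
    Complex.conjCLE.contDiff.comp ((f.smooth ⊤).comp (contDiff_id.sub contDiff_const))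
  let L : Ed d →L[ℝ] ℂ :=
    (-Complex.I) • (Complex.ofRealCLM.comp (innerSL ℝ ξ))
  have hL : ∀ y, L y = -(Complex.I * (⟪y, ξ⟫ : ℝ)) := fun y => by
    simp [L, real_inner_comm]
  have hLn : ‖L‖ ≤ ‖ξ‖ := by
    refine ContinuousLinearMap.opNorm_le_bound _ (norm_nonneg _) fun y => ?_
    rw [hL, norm_neg, norm_mul, Complex.norm_I, one_mul, Complex.norm_real, mul_comm]
    exact norm_inner_le_norm y ξ
  simp_rw [← hL]
  have hexp : ‖Complex.exp (L y)‖ = 1 := by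
    rw [hL, Complex.norm_exp]; simp
  have hfi : ∀ i, ‖iteratedFDeriv ℝ i (fun y => (starRingEnd ℂ) (f (y - x))) y‖ =
      ‖iteratedFDeriv ℝ i f (y - x)‖ := by
    intro i
    have := Complex.conjLIE.norm_iteratedFDeriv_comp_left (fun y => f (y - x)) y i
    rw [iteratedFDeriv_comp_sub] at this
    exact this
  have hy : ‖y‖ ≤ (1 + ‖x‖) * (1 + ‖y - x‖) := by
    have := norm_add_le (y - x) x
    rw [sub_add_cancel] at this
    nlinarith [norm_nonneg x, norm_nonneg (y - x)]
  have hterm : ∀ i ∈ Finset.range (l + 1),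
      (1 + ‖y - x‖) ^ k * ‖iteratedFDeriv ℝ i f (y - x)‖ ≤ S := fun i hi =>
    SchwartzMap.one_add_le_sup_seminorm_apply (𝕜 := ℝ) (m := (k, l)) le_rfl
      (Nat.lt_succ_iff.1 (Finset.mem_range.1 hi)) f (y - x)
  calc _ ≤ ((1 + ‖x‖) * (1 + ‖y - x‖)) ^ k * ∑ i ∈ Finset.range (l + 1),
          (l.choose i : ℝ) * ‖iteratedFDeriv ℝ i f (y - x)‖ * (1 + ‖ξ‖) ^ l := by
        gcongr
        refine (norm_iteratedFDeriv_mul_le hf L.contDiff.cexp y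
          (WithTop.coe_le_coe.2 le_top)).trans (Finset.sum_le_sum fun i _ => ?_)
        rw [hfi]
        gcongr
        refine (norm_iteratedFDeriv_cexp_clm_le L (l - i) y).trans ?_
        rw [hexp, mul_one]
        calc ‖L‖ ^ (l - i) ≤ (1 + ‖ξ‖) ^ (l - i) := by
              gcongr; linarith
          _ ≤ _ := pow_le_pow_right₀ (by linarith [norm_nonneg ξ]) (Nat.sub_le l i)
    _ = ((1 + ‖x‖) ^ k * (1 + ‖ξ‖) ^ l) * ∑ i ∈ Finset.range (l + 1),
          (l.choose i : ℝ) * ((1 + ‖y - x‖) ^ k * ‖iteratedFDeriv ℝ i f (y - x)‖) := by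
        rw [Finset.mul_sum, Finset.mul_sum, mul_pow]
        exact Finset.sum_congr rfl fun i _ => by ring
    _ ≤ ((1 + ‖x‖) ^ k * (1 + ‖ξ‖) ^ l) * ∑ i ∈ Finset.range (l + 1), (l.choose i : ℝ) * S := by
        gcongr with i hi
        exact hterm i hi
    _ = _ := mul_comm _ _

/-- The translated, modulated and conjugated window `y ↦ conj (f (y - x)) e^{-i⟨y,ξ⟩}`. -/
def modulated {d : ℕ} (f : SchwartzMap (Ed d) ℂ) (x ξ : Ed d) : SchwartzMap (Ed d) ℂ where
  toFun y := (starRingEnd ℂ) (f (y - x)) * Complex.exp (-(Complex.I * (⟪y, ξ⟫ : ℝ)))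
  smooth' := by
    have hf : ContDiff ℝ ((⊤ : ℕ∞) : WithTop ℕ∞) fun y => (starRingEnd ℂ) (f (y - x)) :=
      Complex.conjCLE.contDiff.comp ((f.smooth ⊤).comp (contDiff_id.sub contDiff_const))
    exact hf.mul (contDiff_const.mul
      (Complex.ofRealCLM.contDiff.comp (contDiff_id.inner ℝ contDiff_const))).neg.cexp
  decay' k l := by
    obtain ⟨C, -, hC⟩ := norm_iteratedFDeriv_modulated_le f k l
    exact ⟨_, hC x ξ⟩

theorem one_add_pow_mul_le_pnorm {d : ℕ} (z : Ed d × Ed d) (k l : ℕ) :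
    (1 + ‖z.1‖) ^ k * (1 + ‖z.2‖) ^ l ≤ (1 + pnorm z) ^ (k + l) := by
  have h1 : ‖z.1‖ ≤ pnorm z := Real.le_sqrt_of_sq_le (by nlinarith [sq_nonneg ‖z.2‖])
  have h2 : ‖z.2‖ ≤ pnorm z := Real.le_sqrt_of_sq_le (by nlinarith [sq_nonneg ‖z.1‖])
  have h0 : 0 ≤ pnorm z := (norm_nonneg _).trans h1
  rw [pow_add]
  gcongr

theorem IsSTFT.norm_le_pow {d : ℕ} {s : ℝ} {u : TD d} {φ : Ed d → ℂ} {W : Ed d × Ed d → ℂ}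
    (hφ : φ ∈ SigmaGS s d) (hW : IsSTFT u φ W) :
    ∃ (C : ℝ) (N : ℕ), 0 ≤ C ∧ ∀ z, ‖W z‖ ≤ C * (1 + pnorm z) ^ N := by
  let f := SigmaGS.toSchwartz hφ
  obtain ⟨F, C, -, hu⟩ := Seminorm.bound_of_continuous (schwartz_withSeminorms ℂ (Ed d) ℂ)
    ((normSeminorm ℂ ℂ).comp u.toLinearMap) (continuous_norm.comp u.continuous)
  choose B hB0 hB using norm_iteratedFDeriv_modulated_le f
  refine ⟨C * ∑ m ∈ F, B m.1 m.2, ∑ m ∈ F, (m.1 + m.2),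
    mul_nonneg C.2 (Finset.sum_nonneg fun m _ => hB0 _ _), fun z => ?_⟩
  have hp : 0 ≤ pnorm z := Real.sqrt_nonneg _
  rw [show W z = u (modulated f z.1 z.2) from hW z.1 z.2 _ fun y => rfl]
  refine (hu (modulated f z.1 z.2)).trans ?_
  rw [smul_apply, NNReal.smul_def, smul_eq_mul, mul_assoc]
  refine mul_le_mul_of_nonneg_left ?_ C.2
  have hsum : 0 ≤ ∑ m ∈ F, B m.1 m.2 := Finset.sum_nonneg fun m _ => hB0 _ _
  refine Seminorm.finset_sup_apply_le (by positivity) fun m hm => ?_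
  refine SchwartzMap.seminorm_le_bound ℂ m.1 m.2 _ (by positivity) fun y => ?_
  refine (hB m.1 m.2 z.1 z.2 y).trans ?_
  refine mul_le_mul (Finset.single_le_sum (f := fun m : ℕ × ℕ => B m.1 m.2)
    (fun m _ => hB0 _ _) hm) ?_ (by positivity) hsum
  refine (one_add_pow_mul_le_pnorm z _ _).trans ?_
  exact pow_le_pow_right₀ (by linarith)
    (Finset.single_le_sum (f := fun m : ℕ × ℕ => m.1 + m.2) (fun m _ => Nat.zero_le _) hm)

theorem one_add_pow_le_exp_rpow {s : ℝ} (hs : 0 < s) (N : ℕ) :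
    ∃ C : ℝ, 0 ≤ C ∧ ∀ r : ℝ, 0 ≤ r → (1 + r) ^ N ≤ C * Real.exp (r ^ (1 / s)) := by
  obtain ⟨M, hM⟩ := exists_nat_ge (s * N)
  refine ⟨2 ^ N * (1 + M.factorial), by positivity, fun r hr => ?_⟩
  set t := r ^ (1 / s) with ht
  have ht0 : 0 ≤ t := Real.rpow_nonneg hr _
  have hrt : r = t ^ s := by
    rw [ht, ← Real.rpow_mul hr, one_div_mul_cancel hs.ne', Real.rpow_one]
  have he : 1 ≤ Real.exp t := Real.one_le_exp ht0
  have hpow : t ^ M ≤ M.factorial * Real.exp t := by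
    have := Real.pow_div_factorial_le_exp t ht0 M
    rwa [div_le_iff₀' (by positivity)] at this
  have hmain : (max 1 r) ^ N ≤ 1 + t ^ M := by
    rcases le_total r 1 with h | h
    · rw [max_eq_left h, one_pow]; linarith [pow_nonneg ht0 M]
    · rw [max_eq_right h, hrt, ← Real.rpow_natCast, ← Real.rpow_mul ht0]
      have h1 : 1 ≤ t := Real.one_le_rpow h (by positivity)
      have := Real.rpow_le_rpow_of_exponent_le h1 hM
      rw [Real.rpow_natCast] at this
      linarith
  calc (1 + r) ^ N ≤ (2 * max 1 r) ^ N := by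
        gcongr; linarith [le_max_left 1 r, le_max_right 1 r]
    _ = 2 ^ N * max 1 r ^ N := mul_pow _ _ _
    _ ≤ 2 ^ N * ((1 + M.factorial) * Real.exp t) := by
        gcongr; nlinarith
    _ = _ := by ring

theorem exp_mul_norm_mul_bounded {m n N : ℕ} {s c D : ℝ} (hs : 0 < s) (hc : 0 ≤ c) (hD : 0 ≤ D)
    {W₁ : Ed m × Ed m → ℂ} {W₂ : Ed n × Ed n → ℂ} {Γ : Set (Ed m × Ed m)}
    (h₁ : ∀ A : ℝ, 0 < A → ∃ C : ℝ, ∀ z ∈ Γ, Real.exp (A * pnorm z ^ (1 / s)) * ‖W₁ z‖ ≤ C)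
    (h₂ : ∀ z, ‖W₂ z‖ ≤ D * (1 + pnorm z) ^ N) {A : ℝ} (hA : 0 < A) :
    ∃ C : ℝ, ∀ z ∈ Γ, ∀ z', pnorm z' ≤ c * pnorm z →
      Real.exp (A * Real.sqrt (pnorm z ^ 2 + pnorm z' ^ 2) ^ (1 / s)) * (‖W₁ z‖ * ‖W₂ z'‖)
        ≤ C := by
  obtain ⟨K, hK, hexp⟩ := one_add_pow_le_exp_rpow hs N
  let q : ℝ := A * (1 + c) ^ (1 / s) + c ^ (1 / s)
  have hq : 0 < q := by positivity
  obtain ⟨C, hC⟩ := h₁ q hq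
  refine ⟨D * K * C, fun z hz z' hz' => ?_⟩
  have hp : 0 ≤ pnorm z := Real.sqrt_nonneg _
  have hp' : 0 ≤ pnorm z' := Real.sqrt_nonneg _
  have hsqrt : Real.sqrt (pnorm z ^ 2 + pnorm z' ^ 2) ≤ (1 + c) * pnorm z := by
    refine Real.sqrt_le_iff.2 ⟨by positivity, ?_⟩
    nlinarith [mul_nonneg hc hp]
  have hW₂ : ‖W₂ z'‖ ≤ D * (K * Real.exp (c ^ (1 / s) * pnorm z ^ (1 / s))) := by
    refine (h₂ z').trans ?_
    gcongr
    rw [← Real.mul_rpow hc hp]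
    refine le_trans ?_ (hexp _ (mul_nonneg hc hp))
    gcongr
  calc _ ≤ Real.exp (A * ((1 + c) * pnorm z) ^ (1 / s)) *
        (‖W₁ z‖ * (D * (K * Real.exp (c ^ (1 / s) * pnorm z ^ (1 / s))))) := by
        gcongr
    _ = D * K * (Real.exp (q * pnorm z ^ (1 / s)) * ‖W₁ z‖) := by
        rw [Real.mul_rpow (by positivity) hp, add_mul, Real.exp_add]
        ring_nf
    _ ≤ _ := by gcongr; exact hC z hz

theorem continuous_pnorm {d : ℕ} : Continuous (pnorm (d := d)) := by
  unfold pnorm; fun_prop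

theorem pnorm_smul {d : ℕ} {t : ℝ} (ht : 0 < t) (z : Ed d × Ed d) :
    pnorm (t • z) = t * pnorm z := by
  simp only [pnorm, Prod.smul_fst, Prod.smul_snd, norm_smul, Real.norm_of_nonneg ht.le, mul_pow]
  rw [← mul_add, Real.sqrt_mul (by positivity), Real.sqrt_sq ht.le]

theorem pnorm_pos {d : ℕ} {z : Ed d × Ed d} (hz : z ≠ 0) : 0 < pnorm z := by
  refine Real.sqrt_pos.2 ?_
  rcases not_and_or.1 (fun h : z.1 = 0 ∧ z.2 = 0 => hz (Prod.ext h.1 h.2)) with h | h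
  · have := norm_pos_iff.2 h; positivity
  · have := norm_pos_iff.2 h; positivity

theorem pnorm2_eq {m n : ℕ} (z : (Ed m × Ed n) × (Ed m × Ed n)) :
    pnorm2 z = Real.sqrt (pnorm (z.1.1, z.2.1) ^ 2 + pnorm (z.1.2, z.2.2) ^ 2) := by
  simp only [pnorm, pnorm2]
  rw [Real.sq_sqrt (by positivity), Real.sq_sqrt (by positivity)]
  congr 1
  ring

/-- If one factor of a product decays rapidly in a cone around the corresponding component of a
point and the other factor has polynomial growth, the point is not in the wave front set. -/
theorem notMem_WFs2_of_factor {m n a b N : ℕ} {s D : ℝ} (hs : 0 < s) (hD : 0 ≤ D)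
    {W : (Ed m × Ed n) × (Ed m × Ed n) → ℂ} {W₁ : Ed a × Ed a → ℂ} {W₂ : Ed b × Ed b → ℂ}
    (p : (Ed m × Ed n) × (Ed m × Ed n) →L[ℝ] Ed a × Ed a)
    (q : (Ed m × Ed n) × (Ed m × Ed n) →L[ℝ] Ed b × Ed b)
    (hpq : ∀ z, pnorm2 z = Real.sqrt (pnorm (p z) ^ 2 + pnorm (q z) ^ 2))
    (hW : ∀ z, ‖W z‖ = ‖W₁ (p z)‖ * ‖W₂ (q z)‖)
    (h₂ : ∀ z, ‖W₂ z‖ ≤ D * (1 + pnorm z) ^ N)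
    {z₀ : (Ed m × Ed n) × (Ed m × Ed n)} (hz₀ : p z₀ ≠ 0) (hWF : p z₀ ∉ WFs s W₁) :
    z₀ ∉ WFs2 s W := by
  rintro ⟨-, hno⟩
  obtain ⟨Γ, hopen, hconic, h0, hmem, hdecay⟩ := not_not.1 fun h => hWF ⟨hz₀, h⟩
  have hpos := pnorm_pos hz₀
  have hq0 : 0 ≤ pnorm (q z₀) := Real.sqrt_nonneg _
  let c : ℝ := pnorm (q z₀) / pnorm (p z₀) + 1
  refine hno ⟨{z | p z ∈ Γ ∧ pnorm (q z) < c * pnorm (p z)}, ?_, ?_, ?_, ⟨hmem, ?_⟩, ?_⟩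
  · exact (hopen.preimage p.continuous).inter (isOpen_lt (continuous_pnorm.comp q.continuous)
      (continuous_const.mul (continuous_pnorm.comp p.continuous)))
  · rintro t ht z ⟨hz, hlt⟩
    refine ⟨by rw [map_smul]; exact hconic t ht _ hz, ?_⟩
    rw [map_smul, map_smul, pnorm_smul ht, pnorm_smul ht, mul_left_comm]
    gcongr
  · rintro ⟨h, -⟩
    exact h0 (by simpa using h)
  · simp only [c]
    rw [add_mul, div_mul_cancel₀ _ hpos.ne', one_mul]
    linarith
  · intro A hA
    obtain ⟨C, hC⟩ := exp_mul_norm_mul_bounded (c := c) hs (by positivity) hD hdecay h₂ hA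
    refine ⟨C, fun z hz => ?_⟩
    rw [hpq, hW]
    exact hC _ hz.1 _ hz.2.le

theorem statement13 (m n : ℕ) (s : ℝ) (hs : 1/2 < s)
    (u : TD m) (v : TD n)
    (φ : Ed m → ℂ) (hφ : φ ∈ SigmaGS s m) (hφ0 : φ ≠ 0)
    (ψ : Ed n → ℂ) (hψ : ψ ∈ SigmaGS s n) (hψ0 : ψ ≠ 0)
    (Wu : Ed m × Ed m → ℂ) (hWu : IsSTFT u φ Wu)
    (Wv : Ed n × Ed n → ℂ) (hWv : IsSTFT v ψ Wv)
    (w : TD2 m n) (W : (Ed m × Ed n) × (Ed m × Ed n) → ℂ)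
    (hW : IsSTFT2 w (fun p => φ p.1 * ψ p.2) W)
    (hprod : ∀ x ξ : Ed m × Ed n, W (x, ξ) = Wu (x.1, ξ.1) * Wv (x.2, ξ.2)) :
    WFs2 s W ⊆ {z : (Ed m × Ed n) × (Ed m × Ed n) |
      ((z.1.1, z.2.1) ∈ WFs s Wu ∨ (z.1.1, z.2.1) = 0) ∧
      ((z.1.2, z.2.2) ∈ WFs s Wv ∨ (z.1.2, z.2.2) = 0)} := by
  have hs0 : 0 < s := by linarith
  obtain ⟨Cu, Nu, hCu, hu⟩ := hWu.norm_le_pow hφ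
  obtain ⟨Cv, Nv, hCv, hv⟩ := hWv.norm_le_pow hψ
  let p : (Ed m × Ed n) × (Ed m × Ed n) →L[ℝ] Ed m × Ed m :=
    (ContinuousLinearMap.fst ℝ (Ed m) (Ed n)).prodMap (ContinuousLinearMap.fst ℝ (Ed m) (Ed n))
  let q : (Ed m × Ed n) × (Ed m × Ed n) →L[ℝ] Ed n × Ed n :=
    (ContinuousLinearMap.snd ℝ (Ed m) (Ed n)).prodMap (ContinuousLinearMap.snd ℝ (Ed m) (Ed n))
  have hnorm : ∀ z, ‖W z‖ = ‖Wu (p z)‖ * ‖Wv (q z)‖ := fun z => by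
    rw [← norm_mul]; exact congrArg norm (hprod z.1 z.2)
  intro z hz
  refine ⟨?_, ?_⟩
  · by_contra! h
    exact notMem_WFs2_of_factor hs0 hCv p q pnorm2_eq hnorm hv h.2 h.1 hz
  · by_contra! h
    exact notMem_WFs2_of_factor hs0 hCu q p (fun z => by rw [pnorm2_eq, add_comm]; rfl)
      (fun z => by rw [hnorm, mul_comm]) hu h.2 h.1 hz

end
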